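/- arXiv:1312.1674 — 3 statements merged into one kernel-verified Lean document; each statement's English description precedes it below -/
import Mathlib

section
/- Let q be a prime power, let K be a finite field of order q² and F its subfield with q elements. Let g ∈ K[x] be a nonconstant polynomial, let A = K[x]/(g) with ζ the image of x in A, and let h₀, h₁ ∈ K[x] be polynomials such that h₁(ζ)·ζ^q = h₀(ζ) in A. Then for all a, b, c, d ∈ K, the following identity holds in A: h₁(ζ)·(cζ + d)·∏_{α ∈ F} ((a − αc)ζ + (b − αd)) = (ca^q − ac^q)·ζ·h₀(ζ) + (da^q − bc^q)·h₀(ζ) + (cb^q − ad^q)·ζ·h₁(ζ) + (db^q − bd^q)·h₁(ζ). -/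
open Polynomial

/-- Over a finite field, `X ^ q - X` is the product of all monic linear polynomials. -/
theorem FiniteField.prod_X_sub_C_eq_X_pow_card_sub_X (F : Type*) [Field F] [Fintype F] :
    ∏ α : F, (X - C α) = X ^ Fintype.card F - X := by
  have hcard := Fintype.one_lt_card (α := F)
  have hmonic : (X ^ Fintype.card F - X : F[X]).Monic :=
    monic_X_pow_sub (by simpa using hcard)
  rw [← prod_multiset_X_sub_C_of_monic_of_roots_card_eq hmonic
    (by rw [FiniteField.roots_X_pow_card_sub_X, FiniteField.X_pow_card_sub_X_natDegree_eq F hcard]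
        rfl), FiniteField.roots_X_pow_card_sub_X]
  rfl

/-- The homogeneous form of the factorization of `X ^ q - X` over the field with `q` elements. -/
theorem FiniteField.mul_prod_sub_algebraMap_mul (F : Type*) [Field F] [Fintype F]
    {L : Type*} [Field L] [Algebra F L] (u v : L) :
    v * ∏ α : F, (u - algebraMap F L α * v) =
      v * u ^ Fintype.card F - u * v ^ Fintype.card F := by
  rcases eq_or_ne v 0 with rfl | hv
  · simp
  have h := congrArg (aeval (u / v)) (FiniteField.prod_X_sub_C_eq_X_pow_card_sub_X F)
  simp only [map_prod, map_sub, map_pow, aeval_X, aeval_C] at h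
  have hfactor (α : F) : u - algebraMap F L α * v = v * (u / v - algebraMap F L α) := by
    field_simp
  simp only [hfactor, Finset.prod_mul_distrib, Finset.prod_const, Finset.card_univ, h]
  rw [div_pow]
  field_simp

/-- Let `q` be a prime power, `K` a finite field of order `q²` and `F` its subfield with `q`
elements.  Let `g ∈ K[x]` be nonconstant, `A = K[x]/(g)` with `ζ` the image of `x`, and
`h₀, h₁ ∈ K[x]` with `h₁(ζ)·ζ^q = h₀(ζ)` in `A`.  Then for all `a b c d ∈ K`, in `A`:
`h₁(ζ)·(cζ + d)·∏_{α ∈ F} ((a - αc)ζ + (b - αd))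
  = (ca^q - ac^q)·ζ·h₀(ζ) + (da^q - bc^q)·h₀(ζ) + (cb^q - ad^q)·ζ·h₁(ζ)
    + (db^q - bd^q)·h₁(ζ)`. -/
theorem stmt10 {K : Type*} [Field K] [Fintype K] (q : ℕ) (hq : IsPrimePow q)
    (hK : Fintype.card K = q ^ 2) (F : Subfield K) [Fintype F] (hF : Fintype.card F = q)
    (g : Polynomial K) (hg : 0 < g.natDegree) (h₀ h₁ : Polynomial K)
    (hrel : Ideal.Quotient.mk (Ideal.span {g}) h₁ *
        (Ideal.Quotient.mk (Ideal.span {g}) X) ^ q = Ideal.Quotient.mk (Ideal.span {g}) h₀)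
    (a b c d : K) :
    Ideal.Quotient.mk (Ideal.span {g}) h₁ *
        Ideal.Quotient.mk (Ideal.span {g}) (C c * X + C d) *
        ∏ α : F, Ideal.Quotient.mk (Ideal.span {g})
          (C (a - (α : K) * c) * X + C (b - (α : K) * d)) =
      Ideal.Quotient.mk (Ideal.span {g})
        (C (c * a ^ q - a * c ^ q) * X * h₀ + C (d * a ^ q - b * c ^ q) * h₀ +
          C (c * b ^ q - a * d ^ q) * X * h₁ + C (d * b ^ q - b * d ^ q) * h₁) := by
  obtain ⟨p, n, hp, -, rfl⟩ := hq
  have : Fact p.Prime := ⟨hp.nat_prime⟩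
  have : CharP K p := by
    rw [← pow_mul] at hK
    exact charP_of_card_eq_prime_pow hK
  have hfrob (e f : K) : (C e * X + C f) ^ p ^ n =
      C (e ^ p ^ n) * X ^ p ^ n + C (f ^ p ^ n) := by
    rw [add_pow_char_pow, mul_pow, ← C_pow, ← C_pow]
  have hprod : (C c * X + C d) * ∏ α : F,
        (C (a - (α : K) * c) * X + C (b - (α : K) * d)) =
      (C c * X + C d) * (C (a ^ p ^ n) * X ^ p ^ n + C (b ^ p ^ n)) -
        (C a * X + C b) * (C (c ^ p ^ n) * X ^ p ^ n + C (d ^ p ^ n)) := by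
    apply IsFractionRing.injective K[X] (FractionRing K[X])
    have h := FiniteField.mul_prod_sub_algebraMap_mul F
      (algebraMap K[X] (FractionRing K[X]) (C a * X + C b))
      (algebraMap K[X] (FractionRing K[X]) (C c * X + C d))
    rw [hF] at h
    rw [← hfrob, ← hfrob, map_sub, map_mul, map_mul, map_mul, map_pow, map_pow, map_prod, ← h]
    congr 1
    refine Finset.prod_congr rfl fun α _ => ?_
    rw [IsScalarTower.algebraMap_apply F K[X] (FractionRing K[X]), ← map_mul, ← map_sub]
    congr 1
    change _ = C a * X + C b - C (α : K) * (C c * X + C d)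
    simp only [C_sub, C_mul]
    ring
  rw [← map_prod, mul_assoc, ← map_mul, hprod]
  simp only [map_add, map_sub, map_mul, map_pow, ← hrel]
  ring
end

section
/- Let K be a finite field, m ≥ 5 an integer, and r ≥ m an integer. Write r − m = s(m−1) + t with s, t nonnegative integers and t < m−1, and suppose t = 1 (so s ≥ 1). For k ≥ 1 let I_k denote the number of monic irreducible polynomials of degree k in K[x]. Then the number of monic polynomials f of degree r in K[x] such that (i) f has a monic irreducible factor of degree m, (ii) the square of that degree-m irreducible factor does not divide f, and (iii) f has no linear factor, is at least I_m · binom(I_{m−1}, s−1) · I_{m−2} · I_2. -/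
open Polynomial in
/-- Over a finite ring there are finitely many polynomials of any given degree. -/
theorem finite_setOf_natDegree_eq (R : Type*) [Semiring R] [Finite R] (k : ℕ) :
    {f : R[X] | f.natDegree = k}.Finite := by
  refine Set.Finite.of_injOn (f := fun f => fun i : Fin (k + 1) => f.coeff i)
    (t := Set.univ) (fun _ _ => Set.mem_univ _) ?_ Set.finite_univ
  intro f hf g hg hfg
  simp only [Set.mem_ofPred_eq] at hf hg
  ext i
  by_cases hi : i < k + 1
  · exact congrFun hfg ⟨i, hi⟩
  · rw [coeff_eq_zero_of_natDegree_lt (by omega), coeff_eq_zero_of_natDegree_lt (by omega)]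

open Polynomial in
/-- An irreducible divisor of a product of irreducible polynomials is associated to a factor. -/
theorem exists_associated_of_irreducible_dvd_multiset_prod {K : Type*} [Field K]
    {p : K[X]} (hp : Irreducible p) {M : Multiset K[X]} (hM : ∀ q ∈ M, Irreducible q)
    (h : p ∣ M.prod) : ∃ q ∈ M, Associated p q := by
  obtain ⟨q, hq, hpq⟩ := hp.prime.exists_mem_multiset_dvd h
  exact ⟨q, hq, hp.associated_of_dvd (hM q hq) hpq⟩

open Polynomial in
/-- The members of a multiset of monic irreducible polynomials are the monic irreducible
divisors of its product. -/
theorem mem_iff_dvd_multiset_prod {K : Type*} [Field K] {p : K[X]} {M : Multiset K[X]}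
    (hM : ∀ q ∈ M, q.Monic ∧ Irreducible q) :
    p ∈ M ↔ p.Monic ∧ Irreducible p ∧ p ∣ M.prod := by
  refine ⟨fun h => ⟨(hM p h).1, (hM p h).2, Multiset.dvd_prod h⟩, ?_⟩
  rintro ⟨hp, hp', h⟩
  obtain ⟨q, hq, hpq⟩ := exists_associated_of_irreducible_dvd_multiset_prod hp'
    (fun q hq => (hM q hq).2) h
  rwa [eq_of_monic_of_associated hp (hM q hq).1 hpq]

open Polynomial in
/-- The finite set of monic irreducible polynomials of degree `k` over a finite field. -/
noncomputable def monicIrreducibles (K : Type*) [Field K] [Finite K] (k : ℕ) : Finset K[X] :=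
  ((finite_setOf_natDegree_eq K k).subset
    (t := {f | f.Monic ∧ Irreducible f ∧ f.natDegree = k}) fun _ h => h.2.2).toFinset

open Polynomial in
theorem mem_monicIrreducibles {K : Type*} [Field K] [Finite K] {k : ℕ} {f : K[X]} :
    f ∈ monicIrreducibles K k ↔ f.Monic ∧ Irreducible f ∧ f.natDegree = k := by
  simp [monicIrreducibles]


/-- Let `K` be a finite field, `m ≥ 5`, `r ≥ m`, and write `r - m = s(m-1) + t` with
`t < m - 1` and `t = 1` (so `s ≥ 1`).  Let `I k` be the number of monic irreducible
polynomials of degree `k` in `K[x]`.  Then the number of monic polynomials `f` of degree `r`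
having a monic irreducible factor of degree `m` whose square does not divide `f`, and having
no linear factor, is at least `I m * choose (I (m-1)) (s-1) * I (m-2) * I 2`. -/
theorem stmt12 {K : Type*} [Field K] [Fintype K] (m r s : ℕ) (hm : 5 ≤ m) (hrm : m ≤ r)
    (hst : r - m = s * (m - 1) + 1) (ht : 1 < m - 1) (hs : 1 ≤ s)
    (I : ℕ → ℕ)
    (hI : ∀ k, 1 ≤ k →
      I k = Nat.card {f : Polynomial K // f.Monic ∧ Irreducible f ∧ f.natDegree = k}) :
    I m * Nat.choose (I (m - 1)) (s - 1) * I (m - 2) * I 2 ≤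
      Nat.card {f : Polynomial K // f.Monic ∧ f.natDegree = r ∧
        (∃ π : Polynomial K, π.Monic ∧ Irreducible π ∧ π.natDegree = m ∧
          π ∣ f ∧ ¬ π ^ 2 ∣ f) ∧
        ¬ ∃ l : Polynomial K, l.natDegree = 1 ∧ l ∣ f} := by
  have hIk : ∀ k, 1 ≤ k → I k = (monicIrreducibles K k).card := fun k hk => by
    rw [hI k hk]
    exact Nat.subtype_card _ fun _ => mem_monicIrreducibles
  let F := monicIrreducibles K
  have hT := (finite_setOf_natDegree_eq K r).subset
    (t := {f | f.Monic ∧ f.natDegree = r ∧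
        (∃ π : Polynomial K, π.Monic ∧ Irreducible π ∧ π.natDegree = m ∧
          π ∣ f ∧ ¬ π ^ 2 ∣ f) ∧
        ¬ ∃ l : Polynomial K, l.natDegree = 1 ∧ l ∣ f}) fun _ h => h.2.1
  let D := ((F m ×ˢ (F (m - 1)).powersetCard (s - 1)) ×ˢ F (m - 2)) ×ˢ F 2
  let M : ((Polynomial K × Finset (Polynomial K)) × Polynomial K) × Polynomial K →
      Multiset (Polynomial K) := fun x => x.1.1.1 ::ₘ x.1.2 ::ₘ x.2 ::ₘ x.1.1.2.val
  have hD : ∀ x ∈ D, (x.1.1.1.Monic ∧ Irreducible x.1.1.1 ∧ x.1.1.1.natDegree = m) ∧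
      ((∀ p ∈ x.1.1.2, p.Monic ∧ Irreducible p ∧ p.natDegree = m - 1) ∧
        x.1.1.2.card = s - 1) ∧
      (x.1.2.Monic ∧ Irreducible x.1.2 ∧ x.1.2.natDegree = m - 2) ∧
      (x.2.Monic ∧ Irreducible x.2 ∧ x.2.natDegree = 2) := by
    intro x hx
    simp only [D, F, Finset.mem_product, Finset.mem_powersetCard, mem_monicIrreducibles,
      Finset.subset_iff] at hx
    tauto
  have hM : ∀ x ∈ D, ∀ q ∈ M x, q.Monic ∧ Irreducible q := by
    intro x hx q hq
    obtain ⟨ha, ⟨hS, -⟩, hc, hd⟩ := hD x hx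
    simp only [M, Multiset.mem_cons, Finset.mem_val] at hq
    rcases hq with rfl | rfl | rfl | hq
    exacts [⟨ha.1, ha.2.1⟩, ⟨hc.1, hc.2.1⟩, ⟨hd.1, hd.2.1⟩, ⟨(hS q hq).1, (hS q hq).2.1⟩]
  have hle : D.card ≤ hT.toFinset.card := by
    refine Finset.card_le_card_of_injOn (fun x => (M x).prod) ?_ ?_
    · intro x hx
      have hx' : x ∈ D := hx
      obtain ⟨ha, ⟨hS, hcard⟩, hc, hd⟩ := hD x hx'
      have hMx := hM x hx'
      simp only [Set.Finite.coe_toFinset, Set.mem_ofPred_eq]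
      refine ⟨by simpa using Polynomial.monic_multiset_prod_of_monic _ id fun q hq => (hMx q hq).1, ?_,
        ⟨x.1.1.1, ha.1, ha.2.1, ha.2.2, Multiset.dvd_prod (by simp [M]), ?_⟩, ?_⟩
      · rw [Polynomial.natDegree_multiset_prod_of_monic _ fun q hq => (hMx q hq).1]
        have hsum : (x.1.1.2.val.map Polynomial.natDegree).sum = (s - 1) * (m - 1) := by
          rw [← hcard, ← smul_eq_mul]
          exact Finset.sum_eq_card_nsmul fun p hp => (hS p hp).2.2
        simp only [M, Multiset.map_cons, Multiset.sum_cons, hsum, ha.2.2, hc.2.2, hd.2.2]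
        obtain ⟨n, rfl⟩ := Nat.exists_eq_add_of_le' hs
        rw [Nat.add_mul, one_mul] at hst
        simp only [Nat.add_sub_cancel]
        omega
      · simp only [M, Multiset.prod_cons, pow_two]
        rw [mul_dvd_mul_iff_left ha.2.1.ne_zero, ← Multiset.prod_cons, ← Multiset.prod_cons]
        intro h
        obtain ⟨q, hq, hpq⟩ := exists_associated_of_irreducible_dvd_multiset_prod ha.2.1
          (fun q hq => (hMx q (Multiset.mem_cons_of_mem hq)).2) h
        have hdeg := Polynomial.natDegree_eq_of_degree_eq
          (Polynomial.degree_eq_degree_of_associated hpq)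
        simp only [Multiset.mem_cons, Finset.mem_val] at hq
        rcases hq with rfl | rfl | hq
        · omega
        · omega
        · have := (hS q hq).2.2
          omega
      · rintro ⟨l, hl, hdvd⟩
        have hl' : Irreducible l := Polynomial.irreducible_of_degree_eq_one
          ((Polynomial.degree_eq_iff_natDegree_eq_of_pos one_pos).2 hl)
        obtain ⟨q, hq, hpq⟩ := exists_associated_of_irreducible_dvd_multiset_prod hl'
          (fun q hq => (hMx q hq).2) hdvd
        have hdeg := Polynomial.natDegree_eq_of_degree_eq
          (Polynomial.degree_eq_degree_of_associated hpq)
        simp only [M, Multiset.mem_cons, Finset.mem_val] at hq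
        rcases hq with rfl | rfl | rfl | hq
        · omega
        · omega
        · omega
        · have := (hS q hq).2.2
          omega
    · intro x hx y hy hxy
      have hmem : ∀ p, p ∈ M x ↔ p ∈ M y := fun p => by
        rw [mem_iff_dvd_multiset_prod (hM x hx), mem_iff_dvd_multiset_prod (hM y hy)]
        exact iff_of_eq (by rw [show (M x).prod = (M y).prod from hxy])
      have hx' := hD x hx
      have hy' := hD y hy
      obtain ⟨⟨⟨a, S⟩, c⟩, d⟩ := x
      obtain ⟨⟨⟨a', S'⟩, c'⟩, d'⟩ := y
      obtain ⟨⟨-, -, ha⟩, ⟨hS, -⟩, ⟨-, -, hc⟩, -, -, hd⟩ := hx'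
      obtain ⟨⟨-, -, ha'⟩, ⟨hS', -⟩, ⟨-, -, hc'⟩, -, -, hd'⟩ := hy'
      simp only [M, Multiset.mem_cons, Finset.mem_val] at ha hS hc hd ha' hS' hc' hd' hmem
      have hSdeg : ∀ p ∈ S, p.natDegree = m - 1 := fun p hp => (hS p hp).2.2
      have hSdeg' : ∀ p ∈ S', p.natDegree = m - 1 := fun p hp => (hS' p hp).2.2
      clear hS hS'
      have haa : a = a' := by
        rcases (hmem a).1 (by simp) with h | h | h | h <;> grind
      have hcc : c = c' := by
        rcases (hmem c).1 (by simp) with h | h | h | h <;> grind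
      have hdd : d = d' := by
        rcases (hmem d).1 (by simp) with h | h | h | h <;> grind
      have hSS : S = S' := by
        ext p
        have := hmem p
        grind
      rw [haa, hcc, hdd, hSS]
  have hcardD : D.card =
      I m * Nat.choose (I (m - 1)) (s - 1) * I (m - 2) * I 2 := by
    rw [hIk m (by omega), hIk (m - 1) (by omega), hIk (m - 2) (by omega), hIk 2 (by omega)]
    simp only [D, F, Finset.card_product, Finset.card_powersetCard]
  rw [← hcardD]
  exact hle.trans_eq (Nat.subtype_card _ fun _ => by simp).symm
end

section
/- Let K be a finite field of order Q and let h = g·k in K[x], where g is irreducible of degree m and coprime to k. Let B be a positive integer such that gcd(|(K[x]/(k))ˣ|, Q^m − 1) is B-smooth. Let D be a finite set of polynomials in K[x], each coprime to h, whose reductions modulo g generate (K[x]/(g))ˣ, and let G be the subgroup of (K[x]/(h))ˣ generated by the reductions of the elements of D modulo h. Let v be the largest B-smooth divisor of Q^m − 1 and L = (Q^m − 1)/v. Then there exist positive integers w and y such that w is B-smooth, gcd(L, y) = 1, and |G| = L·w·y. -/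
/-- A positive integer is `B`-smooth if every prime dividing it is at most `B`. -/
def IsSmooth (B s : ℕ) : Prop := ∀ p : ℕ, p.Prime → p ∣ s → p ≤ B

open Polynomial

theorem exists_smooth_mul_rough (B t : ℕ) (ht : t ≠ 0) :
    ∃ s y : ℕ, t = s * y ∧ IsSmooth B s ∧ ∀ p : ℕ, p.Prime → p ∣ y → B < p := by
  induction t using induction_on_primes with
  | zero => exact absurd rfl ht
  | one =>
    exact ⟨1, 1, rfl, fun p hp h ↦ absurd (Nat.dvd_one.mp h) hp.ne_one,
      fun p hp h ↦ absurd (Nat.dvd_one.mp h) hp.ne_one⟩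
  | prime_mul p a hp ih =>
    obtain ⟨s, y, rfl, hs, hy⟩ := ih (right_ne_zero_of_mul ht)
    rcases le_or_gt p B with h | h
    · refine ⟨p * s, y, by ring, fun q hq hd ↦ ?_, hy⟩
      rcases (hq.dvd_mul).mp hd with h1 | h1
      · rwa [(Nat.prime_dvd_prime_iff_eq hq hp).mp h1]
      · exact hs q hq h1
    · refine ⟨s, p * y, by ring, hs, fun q hq hd ↦ ?_⟩
      rcases (hq.dvd_mul).mp hd with h1 | h1
      · rwa [(Nat.prime_dvd_prime_iff_eq hq hp).mp h1]
      · exact hy q hq h1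

theorem finite_quotient_span_singleton {K : Type*} [Field K] [Finite K] {f : K[X]}
    (hf : f ≠ 0) : Finite (K[X] ⧸ Ideal.span {f}) :=
  have : Module.Finite K (AdjoinRoot f) := (AdjoinRoot.powerBasis hf).finite
  Module.finite_of_finite K (M := AdjoinRoot f)

theorem card_units_quotient_irreducible {K : Type*} [Field K] [Finite K] {g : K[X]}
    (hg : Irreducible g) :
    Nat.card (K[X] ⧸ Ideal.span {g})ˣ = Nat.card K ^ g.natDegree - 1 := by
  have : Fact (Irreducible g) := ⟨hg⟩
  have : Module.Finite K (AdjoinRoot g) := (AdjoinRoot.powerBasis hg.ne_zero).finite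
  have : Finite (AdjoinRoot g) := Module.finite_of_finite K
  change Nat.card (AdjoinRoot g)ˣ = _
  rw [Nat.card_units, Module.natCard_eq_pow_finrank (K := K),
    (AdjoinRoot.powerBasis hg.ne_zero).finrank, AdjoinRoot.powerBasis_dim]

theorem card_units_quotient_mul {R : Type*} [CommRing R] {g k : R} (hcop : IsCoprime g k) :
    Nat.card (R ⧸ Ideal.span {g * k})ˣ =
      Nat.card (R ⧸ Ideal.span {g})ˣ * Nat.card (R ⧸ Ideal.span {k})ˣ := by
  rw [← Ideal.span_singleton_mul_span_singleton, ← Nat.card_prod]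
  exact Nat.card_congr ((Units.mapEquiv (Ideal.quotientMulEquivQuotientProd _ _
    ((Ideal.isCoprime_span_singleton_iff g k).mpr hcop)).toMulEquiv).trans
      MulEquiv.prodUnits).toEquiv

theorem isUnit_quotient_mk_of_isCoprime {R : Type*} [CommRing R] {f h : R}
    (hf : IsCoprime f h) : IsUnit (Ideal.Quotient.mk (Ideal.span {h}) f) := by
  obtain ⟨a, b, hab⟩ := hf
  refine IsUnit.of_mul_eq_one (Ideal.Quotient.mk _ a) ?_
  rw [← map_mul, ← map_one (Ideal.Quotient.mk _), Ideal.Quotient.eq,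
    Ideal.mem_span_singleton]
  exact ⟨-b, by linear_combination hab⟩

/-- Units generated by reductions modulo `h` surject onto those generated by reductions modulo
a divisor `g` of `h`. -/
theorem card_closure_reductions_dvd {R : Type*} [CommRing R] {g h : R} (hgh : g ∣ h)
    (D : Finset R) (hD : ∀ f ∈ D, IsCoprime f h) :
    Nat.card (Subgroup.closure {u : (R ⧸ Ideal.span {g})ˣ |
        ∃ f ∈ D, (u : R ⧸ Ideal.span {g}) = Ideal.Quotient.mk _ f}) ∣
      Nat.card (Subgroup.closure {u : (R ⧸ Ideal.span {h})ˣ |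
        ∃ f ∈ D, (u : R ⧸ Ideal.span {h}) = Ideal.Quotient.mk _ f}) := by
  have hle : Ideal.span {h} ≤ Ideal.span {g} := Ideal.span_singleton_le_span_singleton.mpr hgh
  set φ : (R ⧸ Ideal.span {h})ˣ →* (R ⧸ Ideal.span {g})ˣ :=
    Units.map (Ideal.Quotient.factor hle : _ →* _)
  refine (Subgroup.card_dvd_of_le ?_).trans (Subgroup.card_map_dvd _ φ)
  rw [Subgroup.closure_le]
  rintro u ⟨f, hf, hu⟩
  obtain ⟨w, hw⟩ := isUnit_quotient_mk_of_isCoprime (hD f hf)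
  refine ⟨w, Subgroup.subset_closure ⟨f, hf, hw⟩, Units.ext ?_⟩
  change Ideal.Quotient.factor hle (w : R ⧸ Ideal.span {h}) = u
  rw [hw, hu, Ideal.Quotient.factor_mk]

/-- Let `K` be a finite field of order `Q` and `h = g * k` in `K[x]`, with `g` irreducible of
degree `m` and coprime to `k`.  Let `B > 0` be such that `gcd(|(K[x]/(k))ˣ|, Q^m - 1)` is
`B`-smooth.  Let `D` be a finite set of polynomials, each coprime to `h`, whose reductions
modulo `g` generate `(K[x]/(g))ˣ`, and let `G ≤ (K[x]/(h))ˣ` be generated by the reductions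
of the elements of `D` modulo `h`.  Let `v` be the largest `B`-smooth divisor of `Q^m - 1`
and `L = (Q^m - 1)/v`.  Then `|G| = L·w·y` with `w` a `B`-smooth positive integer and `y` a
positive integer coprime to `L`. -/
theorem stmt13 {K : Type*} [Field K] [Fintype K] (Q : ℕ) (hQ : Fintype.card K = Q)
    (g k h : Polynomial K) (hh : h = g * k) (hg : Irreducible g) (m : ℕ)
    (hm : g.natDegree = m) (hcop : IsCoprime g k)
    (B : ℕ) (hB : 0 < B)
    (hBsm : IsSmooth B
      (Nat.gcd (Nat.card (Polynomial K ⧸ Ideal.span {k})ˣ) (Q ^ m - 1)))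
    (D : Finset (Polynomial K)) (hD : ∀ f ∈ D, IsCoprime f h)
    (hgen : Subgroup.closure {u : (Polynomial K ⧸ Ideal.span {g})ˣ |
        ∃ f ∈ D, (u : Polynomial K ⧸ Ideal.span {g}) = Ideal.Quotient.mk _ f} = ⊤)
    (G : Subgroup (Polynomial K ⧸ Ideal.span {h})ˣ)
    (hG : G = Subgroup.closure {u : (Polynomial K ⧸ Ideal.span {h})ˣ |
        ∃ f ∈ D, (u : Polynomial K ⧸ Ideal.span {h}) = Ideal.Quotient.mk _ f})
    (v : ℕ) (hv1 : v ∣ Q ^ m - 1) (hv2 : IsSmooth B v)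
    (hv3 : ∀ v' : ℕ, v' ∣ Q ^ m - 1 → IsSmooth B v' → v' ≤ v)
    (L : ℕ) (hL : L = (Q ^ m - 1) / v) :
    ∃ w y : ℕ, 0 < w ∧ 0 < y ∧ IsSmooth B w ∧ Nat.gcd L y = 1 ∧
      Nat.card G = L * w * y := by
  have hk : k ≠ 0 := by
    rintro rfl
    exact hg.not_isUnit (isCoprime_zero_right.mp hcop)
  subst hG hh
  have hN : Nat.card (K[X] ⧸ Ideal.span {g})ˣ = Q ^ m - 1 := by
    rw [card_units_quotient_irreducible hg, Nat.card_eq_fintype_card, hQ, hm]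
  have := finite_quotient_span_singleton hg.ne_zero
  have := finite_quotient_span_singleton (mul_ne_zero hg.ne_zero hk)
  have hN0 : 0 < Q ^ m - 1 := hN ▸ Nat.card_pos
  obtain ⟨t, ht⟩ := card_closure_reductions_dvd (Dvd.intro k rfl : g ∣ g * k) D hD
  rw [hgen, Subgroup.card_top, hN] at ht
  have ht0 : t ≠ 0 := by
    rintro rfl
    exact Nat.card_pos.ne' ht
  have htU : t ∣ Nat.card (K[X] ⧸ Ideal.span {k})ˣ := by
    refine Nat.dvd_of_mul_dvd_mul_left hN0 ?_
    rw [← ht, ← hN, ← card_units_quotient_mul hcop]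
    exact Subgroup.card_subgroup_dvd_card _
  obtain ⟨s, y, rfl, hs, hy⟩ := exists_smooth_mul_rough B t ht0
  have hLv : L * v = Q ^ m - 1 := hL ▸ Nat.div_mul_cancel hv1
  have hv0 : 0 < v := Nat.pos_of_dvd_of_pos hv1 hN0
  refine ⟨v * s, y, Nat.mul_pos hv0 (Nat.pos_of_ne_zero (left_ne_zero_of_mul ht0)),
    Nat.pos_of_ne_zero (right_ne_zero_of_mul ht0), fun p hp hd ↦ ?_,
    Nat.Coprime.gcd_eq_one (Nat.coprime_of_dvd fun p hp hpL hpy ↦ ?_), ?_⟩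
  · exact (hp.dvd_mul.mp hd).elim (hv2 p hp) (hs p hp)
  · exact (hy p hp hpy).not_ge (hBsm p hp (Nat.dvd_gcd ((hpy.mul_left s).trans htU)
      (hLv ▸ hpL.mul_right v)))
  · rw [ht, ← hLv]
    ring
end
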